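/- Let m be a positive integer or half-integer (2m ∈ ℕ) and let ν be an integer with 0 ≤ ν ≤ 2m. Let τ lie in the upper half-plane and z ∈ ℂ with m·z ∉ ℤ + ℤτ. Then ∑_{n=0}^{2m−1} G^{[m]}_{n,ν}(τ, z) = −(−1)^ν η(τ)³ · θ^{(−)}_{ν+1/2, m+1/2}(τ, z) / θ^{(−)}_{1/2, 1/2}(τ, z). -/

import Mathlib

noncomputable section

open Complex

/-- `e2 w = exp (2 π i w)`; with `q = e^{2πiτ}`, the power `q^x` corresponds to `e2 (x * τ)`. -/
def e2 (w : ℂ) : ℂ := Complex.exp (2 * (Real.pi : ℂ) * Complex.I * w)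

/-- Jacobi-type theta function `θ^{(ε)}_{n,m}(τ, z) = ∑_{j∈ℤ} ε^j q^{m(j+n/(2m))²} e^{2πim(j+n/(2m))z}`. -/
def jtheta (ε n m τ z : ℂ) : ℂ :=
  ∑' j : ℤ, ε ^ j *
    e2 (m * ((j : ℂ) + n / (2 * m)) ^ 2 * τ + m * ((j : ℂ) + n / (2 * m)) * z)

/-- Mock theta function `Φ₁^{(ε)[m,s]}(τ, z₁, z₂)`. -/
def Phi1 (ε m s τ z₁ z₂ : ℂ) : ℂ :=
  ∑' j : ℤ, ε ^ j *
    e2 (m * (j : ℂ) * (z₁ + z₂) + s * z₁ + (m * (j : ℂ) ^ 2 + s * (j : ℂ)) * τ) /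
      (1 - e2 (z₁ + (j : ℂ) * τ))

/-- Dedekind eta function `η(τ) = q^{1/24} ∏_{k≥1} (1 - q^k)`. -/
def dedekindEta (τ : ℂ) : ℂ := e2 (τ / 24) * ∏' k : ℕ, (1 - e2 (((k : ℂ) + 1) * τ))

/-- Jacobi theta `ϑ₁₁(τ, z) = i ∑_{j∈ℤ} (−1)^j q^{(j+1/2)²/2} e^{2πi(j+1/2)z}`. -/
def theta11 (τ z : ℂ) : ℂ :=
  Complex.I * ∑' j : ℤ, (-1 : ℂ) ^ j *
    e2 (((j : ℂ) + 1 / 2) ^ 2 / 2 * τ + ((j : ℂ) + 1 / 2) * z)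

/-- Indefinite double sum `(∑_{j,p∈ℤ, 0<p≤j} − ∑_{j,p∈ℤ, j<p≤0}) f j p`. -/
def indefSum (f : ℤ → ℤ → ℂ) : ℂ :=
  ∑' jp : ℤ × ℤ,
    ((if 0 < jp.2 ∧ jp.2 ≤ jp.1 then f jp.1 jp.2 else 0) -
      (if jp.1 < jp.2 ∧ jp.2 ≤ 0 then f jp.1 jp.2 else 0))

/-- `g^{[m]}_{n,ν}(τ)`. -/
def gfun (m : ℂ) (n ν : ℤ) (τ : ℂ) : ℂ :=
  indefSum fun j p =>
    (-1 : ℂ) ^ j *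
      e2 (((m + 1 / 2) * ((j : ℂ) + (ν : ℂ) - ((ν : ℂ) + 1 / 2) / (2 * m + 1)) ^ 2 -
        m * ((p : ℂ) + (ν : ℂ) - (n : ℂ) / (2 * m)) ^ 2) * τ)

/-- `h^{[m]}_{n,ν}(τ, z)`. -/
def hfun (m : ℂ) (n ν : ℤ) (τ z : ℂ) : ℂ :=
  ∑' j : ℤ,
    e2 (m * (j : ℂ) * z + (n : ℂ) * z / 2 +
        (m * (j : ℂ) ^ 2 + (n : ℂ) * ((j : ℂ) + (ν : ℂ))) * τ) /
      (1 - e2 (m * z + 2 * m * ((j : ℂ) + (ν : ℂ)) * τ))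

/-- `G^{[m]}_{n,ν}(τ, z)`. -/
def Gfun (m : ℂ) (n ν : ℤ) (τ z : ℂ) : ℂ :=
  gfun m n ν τ * jtheta 1 (n : ℂ) m τ z +
    (-1 : ℂ) ^ ν * e2 (-(m * (ν : ℂ) ^ 2) * τ) *
      jtheta (-1) ((ν : ℂ) + 1 / 2) (m + 1 / 2) τ 0 * hfun m n ν τ z

/-- `F^{[m](a,b)}_{n,ν}(τ, z)`. -/
def Ffun (m : ℂ) (a b n ν : ℤ) (τ z : ℂ) : ℂ :=
  e2 ((a : ℂ) * z / 2 + (a : ℂ) ^ 2 / (4 * m) * τ) *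
    Gfun m n ν τ (z + (a : ℂ) * τ / m + (b : ℂ) / m)

/-- The coefficient `f_{j,k}` of Lemma 3.1:
`f_{j,k} = (−1)^j q^{(m+1/2)(j+s/(2m+1))² − k²/(4m)} e^{−2πijm(z₁−z₂)+πik(z₁−z₂)}`. -/
def fcoef (m s τ z₁ z₂ : ℂ) (j k : ℤ) : ℂ :=
  (-1 : ℂ) ^ j *
    e2 (((m + 1 / 2) * ((j : ℂ) + s / (2 * m + 1)) ^ 2 - (k : ℂ) ^ 2 / (4 * m)) * τ +
      (-((j : ℂ) * m) + (k : ℂ) / 2) * (z₁ - z₂))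

section

open Filter Topology in
lemma gs (u y : ℝ) (hu : 0 < u) (hu1 : u < 1) (hy : 0 < y) (A B : ℤ) (hA : 0 < A) :
    Summable fun l : ℤ => (1 + |(l:ℝ)|) * (u ^ (A * l ^ 2 + B * l) * y ^ l) := by
  set T : ℝ := -(A * Real.log u) / Real.pi with hT
  have hlog : Real.log u < 0 := Real.log_neg hu hu1
  have hA' : (0:ℝ) < A := by exact_mod_cast hA
  have hTpos : 0 < T := by
    apply div_pos _ Real.pi_pos
    nlinarith
  set S : ℝ := |B * Real.log u + Real.log y| / (2 * Real.pi) with hS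
  have h0 := summable_pow_mul_jacobiTheta₂_term_bound S hTpos 0
  have h1 := summable_pow_mul_jacobiTheta₂_term_bound S hTpos 1
  have h2 := h0.add h1
  refine Summable.of_nonneg_of_le (fun l => by positivity) (fun l => ?_) h2
  have e : (|l| : ℤ) = |(l:ℝ)| := by push_cast; rfl
  rw [pow_zero, pow_one, ← add_mul, e]
  apply mul_le_mul_of_nonneg_left _ (by positivity)
  have : u ^ (A * l ^ 2 + B * l) * y ^ l
      = Real.exp ((A * l^2 + B * l) * Real.log u + l * Real.log y) := by
    rw [Real.exp_add, mul_comm (_ + _), mul_comm (l:ℝ) (Real.log y), ← Real.rpow_def_of_pos hu,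
      ← Real.rpow_def_of_pos hy, Real.rpow_intCast]
    congr 1
    rw [← Real.rpow_intCast]
    push_cast
    rfl
  rw [this]
  apply Real.exp_le_exp.mpr
  have hpi := Real.pi_pos
  have e1 : -Real.pi * (T * (l:ℝ) ^ 2 - 2 * S * |(l:ℝ)|)
      = A * Real.log u * l^2 + |B * Real.log u + Real.log y| * |(l:ℝ)| := by
    rw [hT, hS]; field_simp; ring
  rw [e1, ← abs_mul]
  have := le_abs_self ((B * Real.log u + Real.log y) * (l:ℝ))
  nlinarith

/-- complex version -/
lemma gsC (Q y : ℂ) (hQ : Q ≠ 0) (hQ1 : ‖Q‖ < 1) (hy : y ≠ 0) (A B : ℤ) (hA : 0 < A) (C : ℝ)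
    (c : ℤ → ℂ) (hc : ∀ l, ‖c l‖ ≤ C * (1 + |(l:ℝ)|)) :
    Summable fun l : ℤ => ‖c l * (Q ^ (A * l ^ 2 + B * l) * y ^ l)‖ := by
  have h := (gs ‖Q‖ ‖y‖ (norm_pos_iff.mpr hQ) hQ1 (norm_pos_iff.mpr hy) A B hA).mul_left C
  refine Summable.of_nonneg_of_le (fun l => by positivity) (fun l => ?_) h
  rw [norm_mul, norm_mul, norm_zpow, norm_zpow, ← mul_assoc C]
  exact mul_le_mul_of_nonneg_right (hc l) (by positivity)

def qp (Q : ℂ) (n : ℕ) : ℂ := ∏ i ∈ Finset.range n, (1 - (Q ^ 2) ^ (i + 1))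

def ip (Q : ℂ) (k : ℤ) : ℂ := if k < 0 then 0 else (qp Q k.toNat)⁻¹

lemma one_sub_ne {Q : ℂ} (hQ1 : ‖Q‖ < 1) (i : ℕ) : 1 - (Q ^ 2) ^ (i + 1) ≠ 0 := by
  intro h
  have h1 : (Q ^ 2) ^ (i + 1) = 1 := (sub_eq_zero.mp h).symm
  have h2 : ‖Q‖ ^ (2 * (i + 1)) = 1 := by
    rw [pow_mul, ← norm_pow, ← norm_pow, h1, norm_one]
  have := pow_lt_one₀ (norm_nonneg Q) hQ1 (n := 2 * (i+1)) (by omega)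
  linarith

lemma qp_ne {Q : ℂ} (hQ1 : ‖Q‖ < 1) (n : ℕ) : qp Q n ≠ 0 :=
  Finset.prod_ne_zero_iff.mpr fun i _ => one_sub_ne hQ1 i

lemma ip_rec {Q : ℂ} (hQ1 : ‖Q‖ < 1) (k : ℤ) : ip Q (k - 1) = ip Q k * (1 - Q ^ (2 * k)) := by
  rcases lt_trichotomy k 0 with h | h | h
  · rw [ip, ip, if_pos h, if_pos (by omega), zero_mul]
  · subst h; simp [ip]
  · obtain ⟨n, rfl⟩ : ∃ n : ℕ, k = n + 1 := ⟨(k-1).toNat, by omega⟩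
    rw [ip, ip, if_neg (by omega), if_neg (by omega)]
    have e1 : ((n:ℤ) + 1 - 1).toNat = n := by omega
    have ex2 : ((n:ℤ) + 1).toNat = n + 1 := by omega
    have e3 : Q ^ (2 * ((n:ℤ) + 1)) = (Q ^ 2) ^ (n + 1) := by
      rw [← pow_mul]; exact_mod_cast zpow_natCast Q (2 * (n+1))
    rw [e1, ex2, e3, qp, qp, Finset.prod_range_succ]
    have := one_sub_ne hQ1 n
    have h2 : (∏ i ∈ Finset.range n, (1 - (Q ^ 2) ^ (i + 1))) ≠ 0 := qp_ne hQ1 n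
    field_simp

def qpinf (Q : ℂ) : ℂ := ∏' i : ℕ, (1 - (Q ^ 2) ^ (i + 1))

lemma norm_sq_lt {Q : ℂ} (hQ1 : ‖Q‖ < 1) : ‖Q ^ 2‖ < 1 := by
  rw [norm_pow]; exact pow_lt_one₀ (norm_nonneg Q) hQ1 (by norm_num)

open Filter Topology

lemma qp_tendsto {Q : ℂ} (hQ1 : ‖Q‖ < 1) : Tendsto (qp Q) atTop (𝓝 (qpinf Q)) :=
  (ModularForm.multipliable_one_sub_pow (norm_sq_lt hQ1)).tendsto_prod_tprod_nat

lemma qpinf_ne {Q : ℂ} (hQ1 : ‖Q‖ < 1) : qpinf Q ≠ 0 := by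
  have := tprod_one_add_ne_zero_of_summable (f := fun i : ℕ => -(Q ^ 2) ^ (i + 1)) ?_ ?_
  · simpa [qpinf, sub_eq_add_neg] using this
  · intro i; simpa [sub_eq_add_neg] using one_sub_ne hQ1 i
  · simp only [norm_neg, norm_pow]
    have h := norm_sq_lt hQ1
    rw [norm_pow] at h
    exact (summable_nat_add_iff 1).mpr (summable_geometric_of_lt_one (by positivity) h)

lemma ipinv_tendsto {Q : ℂ} (hQ1 : ‖Q‖ < 1) :
    Tendsto (fun n => (qp Q n)⁻¹) atTop (𝓝 (qpinf Q)⁻¹) :=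
  (qp_tendsto hQ1).inv₀ (qpinf_ne hQ1)

lemma ip_bdd {Q : ℂ} (hQ1 : ‖Q‖ < 1) : ∃ C : ℝ, 0 < C ∧ ∀ k, ‖ip Q k‖ ≤ C := by
  obtain ⟨C, hC⟩ := (Metric.isBounded_range_of_tendsto _ (ipinv_tendsto hQ1)).exists_norm_le
  refine ⟨max C 1, by positivity, fun k => ?_⟩
  rw [ip]
  split_ifs
  · simp
  · exact (hC _ ⟨_, rfl⟩).trans (le_max_left _ _)

lemma ip_tendsto {Q : ℂ} (hQ1 : ‖Q‖ < 1) (l : ℤ) :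
    Tendsto (fun n : ℕ => ip Q (n + l)) atTop (𝓝 (qpinf Q)⁻¹) := by
  have h : Tendsto (fun n : ℕ => ((n:ℤ) + l).toNat) atTop atTop := by
    rw [tendsto_atTop]
    intro b
    filter_upwards [eventually_ge_atTop (b + l.natAbs)] with n hn
    omega
  refine ((ipinv_tendsto hQ1).comp h).congr' ?_
  filter_upwards [eventually_ge_atTop (l.natAbs)] with n hn
  rw [ip, if_neg (by omega)]
  rfl

end

section
open Filter Topology

def Ft (Q w : ℂ) (n : ℕ) (l : ℤ) : ℂ :=
  (-1) ^ l * (Q ^ (l ^ 2 - l) * w ^ l) * (ip Q (n + l) * ip Q (n - l))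

lemma norm_neg_one_zpow' (l : ℤ) : ‖(-1 : ℂ) ^ l‖ = 1 := by
  rw [norm_zpow, norm_neg, norm_one, one_zpow]

lemma theta_summable {Q w : ℂ} (hQ : Q ≠ 0) (hQ1 : ‖Q‖ < 1) (hw : w ≠ 0) :
    Summable fun l : ℤ => ‖(-1 : ℂ) ^ l * (Q ^ (l ^ 2 - l) * w ^ l)‖ := by
  have := gsC Q w hQ hQ1 hw 1 (-1) one_pos 1 (fun l => (-1) ^ l)
    (fun l => by rw [norm_neg_one_zpow']; simp)
  refine this.congr fun l => ?_
  rw [show 1 * l ^ 2 + -1 * l = l ^ 2 - l by ring]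

lemma Ft_le {Q : ℂ} {C : ℝ} (hC0 : 0 < C) (hC : ∀ k, ‖ip Q k‖ ≤ C) (w : ℂ) (n : ℕ) (l : ℤ) :
    ‖Ft Q w n l‖ ≤ ‖(-1 : ℂ) ^ l * (Q ^ (l ^ 2 - l) * w ^ l)‖ * (C * C) := by
  rw [Ft, norm_mul, norm_mul (ip _ _)]
  gcongr <;> apply hC

lemma Ft_summable {Q w : ℂ} (hQ : Q ≠ 0) (hQ1 : ‖Q‖ < 1) (hw : w ≠ 0) (n : ℕ) :
    Summable (Ft Q w n) := by
  obtain ⟨C, hC0, hC⟩ := ip_bdd hQ1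
  exact Summable.of_norm_bounded ((theta_summable hQ hQ1 hw).mul_right (C * C))
    (fun l => Ft_le hC0 hC w n l)

lemma Ft_rec {Q w : ℂ} (hQ : Q ≠ 0) (hQ1 : ‖Q‖ < 1) (hw : w ≠ 0) (n : ℕ) (l : ℤ) :
    (1 - (Q ^ 2) ^ (2 * n + 1)) * (1 - (Q ^ 2) ^ (2 * n + 1 + 1)) * Ft Q w (n + 1) l =
      (1 + (Q ^ 2) ^ (2 * n + 1)) * Ft Q w n l - (Q ^ 2) ^ n * w * Ft Q w n (l - 1)
        - (Q ^ 2) ^ (n + 1) * w⁻¹ * Ft Q w n (l + 1) := by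
  simp only [Ft]
  push_cast
  set a := Q ^ (2 * ((n : ℤ) + l + 1)) with ha
  set b := Q ^ (2 * ((n : ℤ) - l + 1)) with hb
  have i1 : ip Q (n + l) = ip Q (n + 1 + l) * (1 - a) := by
    rw [show (n:ℤ) + l = (n + 1 + l) - 1 by ring, ip_rec hQ1, ha]
    congr 4; ring
  have i2 : ip Q (n - l) = ip Q (n + 1 - l) * (1 - b) := by
    rw [show (n:ℤ) - l = (n + 1 - l) - 1 by ring, ip_rec hQ1, hb]
    congr 4; ring
  have i3 : ip Q (n + (l - 1)) = ip Q (n + 1 + l) * (1 - a) * (1 - a / Q ^ 2) := by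
    rw [← i1, show (n:ℤ) + (l - 1) = (n + l) - 1 by ring, ip_rec hQ1, ha,
      ← zpow_natCast Q 2, ← zpow_sub₀ hQ]
    congr 4; push_cast; ring
  have i4 : ip Q (n - (l + 1)) = ip Q (n + 1 - l) * (1 - b) * (1 - b / Q ^ 2) := by
    rw [← i2, show (n:ℤ) - (l + 1) = (n - l) - 1 by ring, ip_rec hQ1, hb,
      ← zpow_natCast Q 2, ← zpow_sub₀ hQ]
    congr 4; push_cast; ring
  have i5 : (n:ℤ) - (l - 1) = n + 1 - l := by ring
  have i6 : (n:ℤ) + (l + 1) = n + 1 + l := by ring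
  rw [i1, i2, i3, i4, i5, i6]
  have j1 : (Q ^ 2) ^ (2 * n + 1) = a * b / Q ^ 2 := by
    rw [ha, hb, ← zpow_natCast Q 2, ← zpow_add₀ hQ, ← zpow_sub₀ hQ, ← zpow_natCast, ← zpow_mul]
    congr 1; push_cast; ring
  have j2 : (Q ^ 2) ^ (2 * n + 1 + 1) = a * b := by
    rw [pow_succ, j1]; field_simp
  have j3 : Q ^ ((l - 1) ^ 2 - (l - 1)) * (Q ^ 2) ^ n = Q ^ (l ^ 2 - l) * b := by
    rw [hb, ← zpow_add₀ hQ, ← zpow_natCast Q 2, ← zpow_natCast, ← zpow_mul, ← zpow_add₀ hQ]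
    congr 1; push_cast; ring
  have j4 : Q ^ ((l + 1) ^ 2 - (l + 1)) * (Q ^ 2) ^ (n + 1) = Q ^ (l ^ 2 - l) * a := by
    rw [ha, ← zpow_add₀ hQ, ← zpow_natCast Q 2, ← zpow_natCast, ← zpow_mul, ← zpow_add₀ hQ]
    congr 1; push_cast; ring
  have k1 : (-1 : ℂ) ^ (l - 1) = - (-1) ^ l := by
    rw [zpow_sub₀ (by norm_num), zpow_one, div_neg, div_one]
  have k2 : (-1 : ℂ) ^ (l + 1) = - (-1) ^ l := by
    rw [zpow_add₀ (by norm_num)]; norm_num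
  have k3 : w ^ (l - 1) = w ^ l * w⁻¹ := by
    rw [zpow_sub₀ hw, zpow_one, div_eq_mul_inv]
  have k4 : w ^ (l + 1) = w ^ l * w := by
    rw [zpow_add₀ hw, zpow_one]
  rw [j1, j2, k1, k2, k3, k4]
  generalize ip Q (n + 1 + l) = A
  generalize ip Q (n + 1 - l) = B
  generalize Q ^ ((l - 1) ^ 2 - (l - 1)) = X1 at *
  generalize Q ^ ((l + 1) ^ 2 - (l + 1)) = X2 at *
  generalize (Q ^ 2) ^ n = X3 at *
  generalize (Q ^ 2) ^ (n + 1) = X4 at *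
  generalize Q ^ (l ^ 2 - l) = X at *
  have : (-1 : ℂ) ^ l * (X * w ^ l) * (A * B) * ((1 - a * b / Q ^ 2) * (1 - a * b)) =
     (-1 : ℂ) ^ l * (X * w ^ l) * (A * B) * ((1 + a * b / Q ^ 2) * (1 - a) * (1 - b)
      + b * (1 - a) * (1 - a / Q ^ 2) + a * (1 - b) * (1 - b / Q ^ 2)) := by
    field_simp; ring
  rw [mul_comm, this]
  have e1 : w⁻¹ * w = 1 := inv_mul_cancel₀ hw
  linear_combination (-(-1 : ℂ) ^ l * w ^ l * A * B * (1 - a) * (1 - a / Q ^ 2)) * j3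
    - ((-1 : ℂ) ^ l * w ^ l * A * B * (1 - b) * (1 - b / Q ^ 2)) * j4
    - ((-1 : ℂ) ^ l * w ^ l * A * B) * (X1 * X3 * (1 - a) * (1 - a / Q ^ 2) 
    + X2 * X4 * (1 - b) * (1 - b / Q ^ 2)) * e1

def qw (Q w : ℂ) (n : ℕ) : ℂ :=
  ∏ i ∈ Finset.range n, ((1 - w * (Q ^ 2) ^ i) * (1 - w⁻¹ * (Q ^ 2) ^ (i + 1)))

lemma Ft_zero {Q w : ℂ} : ∑' l, Ft Q w 0 l = 1 := by
  rw [tsum_eq_single 0]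
  · simp [Ft, ip, qp]
  · intro l hl
    rw [Ft]
    rcases lt_or_gt_of_ne hl with h | h
    · rw [show ip Q ((0:ℕ) + l) = 0 by rw [ip, if_pos (by push_cast; omega)]]; simp
    · rw [show ip Q ((0:ℕ) - l) = 0 by rw [ip, if_pos (by push_cast; omega)]]; simp

lemma Ft_prod {Q w : ℂ} (hQ : Q ≠ 0) (hQ1 : ‖Q‖ < 1) (hw : w ≠ 0) (n : ℕ) :
    qp Q (2 * n) * ∑' l, Ft Q w n l = qw Q w n := by
  induction n with
  | zero => rw [Ft_zero]; simp [qp, qw]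
  | succ n ih =>
    have hs := Ft_summable hQ hQ1 hw n
    have hS := hs.hasSum
    have s1 : HasSum (fun l => Ft Q w n (l - 1)) (∑' l, Ft Q w n l) := by
      simpa [Function.comp_def] using (Equiv.subRight (1:ℤ)).hasSum_iff.mpr hS
    have s2 : HasSum (fun l => Ft Q w n (l + 1)) (∑' l, Ft Q w n l) := by
      simpa [Function.comp_def] using (Equiv.addRight (1:ℤ)).hasSum_iff.mpr hS
    have s3 := ((hS.mul_left (1 + (Q ^ 2) ^ (2 * n + 1))).sub
      (s1.mul_left ((Q ^ 2) ^ n * w))).sub (s2.mul_left ((Q ^ 2) ^ (n + 1) * w⁻¹))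
    have s4 := (Ft_summable hQ hQ1 hw (n + 1)).hasSum.mul_left
      ((1 - (Q ^ 2) ^ (2 * n + 1)) * (1 - (Q ^ 2) ^ (2 * n + 1 + 1)))
    have s5 := s4.unique (by simpa only [Ft_rec hQ hQ1 hw] using s3)
    rw [qw, Finset.prod_range_succ, ← qw, ← ih, show 2 * (n + 1) = 2 * n + 1 + 1 by ring, qp,
      Finset.prod_range_succ, Finset.prod_range_succ, ← qp, mul_assoc, mul_assoc, ← mul_assoc (1 - _),
      s5]
    generalize ∑' l, Ft Q w n l = X
    ring_nf
    simp only [mul_inv_cancel_right₀ hw]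

end

section
open Filter Topology

lemma inv_bdd {Q w : ℂ} (hQ : Q ≠ 0) (hQ1 : ‖Q‖ < 1) (hw : w ≠ 0) :
    ∃ C : ℝ, 0 < C ∧ ∀ k : ℤ, ‖(1 - w * Q ^ (2 * k))⁻¹‖ ≤ C := by
  have hq := tendsto_pow_atTop_nhds_zero_of_norm_lt_one (norm_sq_lt hQ1)
  have t1 : Tendsto (fun n : ℕ => (1 - w * (Q ^ 2) ^ n)⁻¹) atTop (𝓝 ((1 - w * 0)⁻¹)) :=
    (tendsto_const_nhds.sub (hq.const_mul w)).inv₀ (by simp)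
  have t2 : Tendsto (fun n : ℕ => (Q ^ 2) ^ n / ((Q ^ 2) ^ n - w)) atTop (𝓝 (0 / (0 - w))) :=
    hq.div (hq.sub tendsto_const_nhds) (by simpa using hw)
  obtain ⟨C1, h1⟩ := (Metric.isBounded_range_of_tendsto _ t1).exists_norm_le
  obtain ⟨C2, h2⟩ := (Metric.isBounded_range_of_tendsto _ t2).exists_norm_le
  refine ⟨max (max C1 C2) 1, by positivity, fun k => ?_⟩
  refine le_trans ?_ (le_max_left _ _)
  obtain ⟨n, rfl | rfl⟩ := k.eq_nat_or_neg
  · refine le_trans ?_ (le_max_left _ _)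
    have := h1 _ ⟨n, rfl⟩
    simp only [← pow_mul] at this
    rwa [← zpow_natCast, Nat.cast_mul] at this
  · refine le_trans ?_ (le_max_right _ _)
    have := h2 _ ⟨n, rfl⟩
    have e : (1 - w * Q ^ (2 * -(n:ℤ)))⁻¹ = (Q ^ 2) ^ n / ((Q ^ 2) ^ n - w) := by
      have e1 : Q ^ (2 * -(n:ℤ)) = ((Q ^ 2) ^ n)⁻¹ := by
        rw [← pow_mul, ← zpow_natCast, Nat.cast_mul, mul_neg, zpow_neg]; rfl
      have h0 : (Q ^ 2) ^ n ≠ 0 := by positivity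
      rw [e1, show 1 - w * ((Q ^ 2) ^ n)⁻¹ = ((Q ^ 2) ^ n - w) / (Q ^ 2) ^ n by field_simp, inv_div]
    rwa [e]

def bt (Q : ℂ) (k : ℤ) : ℂ := (-1) ^ k * Q ^ (k ^ 2 + k)

def Rt (Q w : ℂ) (n : ℕ) (k : ℤ) : ℂ :=
  bt Q k * (1 - w * Q ^ (2 * k))⁻¹ * (ip Q (n + k) * ip Q (n - k))

lemma S_summable {Q w : ℂ} (hQ : Q ≠ 0) (hQ1 : ‖Q‖ < 1) (hw : w ≠ 0) :
    Summable fun k : ℤ => ‖bt Q k * (1 - w * Q ^ (2 * k))⁻¹‖ := by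
  obtain ⟨C, hC0, hC⟩ := inv_bdd hQ hQ1 hw
  have := gsC Q 1 hQ hQ1 one_ne_zero 1 1 one_pos C
    (fun k => (-1) ^ k * (1 - w * Q ^ (2 * k))⁻¹)
    (fun l => by
      rw [norm_mul, norm_neg_one_zpow', one_mul]
      refine (hC l).trans ?_
      have := abs_nonneg (l:ℝ)
      nlinarith)
  refine this.congr fun l => ?_
  rw [bt, one_zpow, one_mul, one_mul, mul_one, mul_right_comm]

lemma Rt_le {Q : ℂ} {C : ℝ} (hC0 : 0 < C) (hC : ∀ k, ‖ip Q k‖ ≤ C) (w : ℂ) (n : ℕ) (l : ℤ) :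
    ‖Rt Q w n l‖ ≤ ‖bt Q l * (1 - w * Q ^ (2 * l))⁻¹‖ * (C * C) := by
  rw [Rt, norm_mul, norm_mul (ip _ _)]
  gcongr <;> apply hC

lemma Rt_summable {Q w : ℂ} (hQ : Q ≠ 0) (hQ1 : ‖Q‖ < 1) (hw : w ≠ 0) (n : ℕ) :
    Summable (Rt Q w n) := by
  obtain ⟨C, hC0, hC⟩ := ip_bdd hQ1
  exact Summable.of_norm_bounded ((S_summable hQ hQ1 hw).mul_right (C * C))
    (fun l => Rt_le hC0 hC w n l)

lemma Ft_one {Q : ℂ} (hQ : Q ≠ 0) (hQ1 : ‖Q‖ < 1) (n : ℕ) : ∑' l, Ft Q 1 (n + 1) l = 0 := by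
  have := Ft_prod hQ hQ1 one_ne_zero (n + 1)
  rw [qw, Finset.prod_range_succ'] at this
  simpa [qp_ne hQ1] using this

lemma Ft_q {Q : ℂ} (hQ : Q ≠ 0) (hQ1 : ‖Q‖ < 1) (n : ℕ) : ∑' l, Ft Q (Q ^ 2) (n + 1) l = 0 := by
  have := Ft_prod hQ hQ1 (pow_ne_zero 2 hQ) (n + 1)
  rw [qw, Finset.prod_range_succ'] at this
  simpa [qp_ne hQ1, hQ] using this

lemma Rt_rec {Q w : ℂ} (hQ : Q ≠ 0) (hQ1 : ‖Q‖ < 1) (hw : w ≠ 0)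
    (hw1 : ∀ k : ℤ, 1 - w * Q ^ (2 * k) ≠ 0) (n : ℕ) (k : ℤ) :
    (1 - w * (Q ^ 2) ^ (n + 1)) * (1 - w⁻¹ * (Q ^ 2) ^ (n + 1)) * Rt Q w (n + 1) k =
      Rt Q w n k + (Q ^ 2) ^ (n + 1) * Ft Q 1 (n + 1) k
        - (Q ^ 2) ^ (n + 1) * w⁻¹ * Ft Q (Q ^ 2) (n + 1) k := by
  simp only [Ft, Rt, bt]
  push_cast
  set x := Q ^ (2 * k) with hx
  have hx0 : x ≠ 0 := zpow_ne_zero _ hQ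
  set y := (Q ^ 2) ^ (n + 1) with hy
  have hyz : y = Q ^ (2 * ((n:ℤ) + 1)) := by
    rw [hy, ← pow_mul, ← zpow_natCast]; push_cast; rfl
  have i1 : ip Q (n + k) = ip Q (n + 1 + k) * (1 - y * x) := by
    rw [show (n:ℤ) + k = (n + 1 + k) - 1 by ring, ip_rec hQ1, hyz, hx, ← zpow_add₀ hQ]
    congr 4; ring
  have i2 : ip Q (n - k) = ip Q (n + 1 - k) * (1 - y / x) := by
    rw [show (n:ℤ) - k = (n + 1 - k) - 1 by ring, ip_rec hQ1, hyz, hx, ← zpow_sub₀ hQ]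
    congr 4; ring
  have j1 : Q ^ (k ^ 2 + k) = Q ^ (k ^ 2 - k) * x := by
    rw [hx, ← zpow_add₀ hQ]; congr 1; ring
  have j2 : (Q ^ 2) ^ k = x := by
    rw [hx, zpow_mul]; rfl
  rw [i1, i2, j1, j2, one_zpow]
  have h1 : 1 - w * x ≠ 0 := hw1 k
  field_simp
  ring

lemma Rt_prod {Q w : ℂ} (hQ : Q ≠ 0) (hQ1 : ‖Q‖ < 1) (hw : w ≠ 0)
    (hw1 : ∀ k : ℤ, 1 - w * Q ^ (2 * k) ≠ 0) (n : ℕ) :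
    qw Q w n * (1 - w * (Q ^ 2) ^ n) * ∑' l, Rt Q w n l = 1 := by
  induction n with
  | zero =>
    rw [tsum_eq_single 0]
    · have := hw1 0
      simp [Rt, bt, ip, qp, qw] at this ⊢
      field_simp
    · intro l hl
      rw [Rt]
      rcases lt_or_gt_of_ne hl with h | h
      · rw [show ip Q ((0:ℕ) + l) = 0 by rw [ip, if_pos (by push_cast; omega)]]; simp
      · rw [show ip Q ((0:ℕ) - l) = 0 by rw [ip, if_pos (by push_cast; omega)]]; simp
  | succ n ih =>
    have s1 := (Ft_summable hQ hQ1 one_ne_zero (n + 1)).hasSum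
    have s2 := (Ft_summable hQ hQ1 (pow_ne_zero 2 hQ) (n + 1)).hasSum
    rw [Ft_one hQ hQ1] at s1
    rw [Ft_q hQ hQ1] at s2
    have s3 := ((Rt_summable hQ hQ1 hw n).hasSum.add (s1.mul_left ((Q ^ 2) ^ (n + 1)))).sub
      (s2.mul_left ((Q ^ 2) ^ (n + 1) * w⁻¹))
    have s4 := (Rt_summable hQ hQ1 hw (n + 1)).hasSum.mul_left
      ((1 - w * (Q ^ 2) ^ (n + 1)) * (1 - w⁻¹ * (Q ^ 2) ^ (n + 1)))
    have s5 := s4.unique (by simpa only [Rt_rec hQ hQ1 hw hw1] using s3)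
    refine Eq.trans ?_ ih
    rw [qw, Finset.prod_range_succ, ← qw]
    linear_combination (qw Q w n * (1 - w * (Q ^ 2) ^ n)) * s5

/-- `Θ₁(w) S(w) = (q)_∞³`. -/
lemma theta_S {Q w : ℂ} (hQ : Q ≠ 0) (hQ1 : ‖Q‖ < 1) (hw : w ≠ 0)
    (hw1 : ∀ k : ℤ, 1 - w * Q ^ (2 * k) ≠ 0) :
    (∑' l : ℤ, (-1 : ℂ) ^ l * (Q ^ (l ^ 2 - l) * w ^ l)) *
      (∑' k : ℤ, bt Q k * (1 - w * Q ^ (2 * k))⁻¹) = qpinf Q ^ 3 := by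
  obtain ⟨C, hC0, hC⟩ := ip_bdd hQ1
  have hp := qpinf_ne hQ1
  have hip : ∀ l : ℤ, Tendsto (fun n : ℕ => ip Q (n + l) * ip Q (n - l)) atTop
      (𝓝 ((qpinf Q)⁻¹ * (qpinf Q)⁻¹)) := fun l => by
    have h1 := ip_tendsto hQ1 l
    have h2 := ip_tendsto hQ1 (-l)
    exact h1.mul h2
  have t1 := tendsto_tsum_of_dominated_convergence (𝓕 := atTop) (f := Ft Q w)
    ((theta_summable hQ hQ1 hw).mul_right (C * C)) (fun l => (hip l).const_mul _)
    (Eventually.of_forall fun n l => Ft_le hC0 hC w n l)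
  have t2 := tendsto_tsum_of_dominated_convergence (𝓕 := atTop) (f := Rt Q w)
    ((S_summable hQ hQ1 hw).mul_right (C * C)) (fun l => (hip l).const_mul _)
    (Eventually.of_forall fun n l => Rt_le hC0 hC w n l)
  have hq := tendsto_pow_atTop_nhds_zero_of_norm_lt_one (norm_sq_lt hQ1)
  have t3 : Tendsto (fun n : ℕ => 1 - w * (Q ^ 2) ^ n) atTop (𝓝 (1 - w * 0)) :=
    tendsto_const_nhds.sub (hq.const_mul w)
  have t4 : Tendsto (fun n : ℕ => qp Q (2 * n)) atTop (𝓝 (qpinf Q)) :=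
    (qp_tendsto hQ1).comp (tendsto_id.const_mul_atTop' (by norm_num))
  have t5 := ((t4.mul t1).mul t3).mul t2
  have t6 := tendsto_nhds_unique t5 (tendsto_const_nhds.congr fun n => by
    rw [Ft_prod hQ hQ1 hw, Rt_prod hQ hQ1 hw hw1] : Tendsto _ _ (𝓝 (1:ℂ)))
  rw [tsum_mul_right, tsum_mul_right] at t6
  generalize (∑' l : ℤ, (-1 : ℂ) ^ l * (Q ^ (l ^ 2 - l) * w ^ l)) = X at *
  generalize (∑' k : ℤ, bt Q k * (1 - w * Q ^ (2 * k))⁻¹) = Y at *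
  field_simp at t6
  linear_combination t6

end

section
open Filter Topology

def sg (a b k : ℤ) : ℂ :=
  (if a ≤ k ∧ k < b then 1 else 0) - (if b ≤ k ∧ k < a then 1 else 0)

lemma sg_swap (a b k : ℤ) : sg a b k = - sg b a k := by
  rw [sg, sg]; ring

lemma sg_norm (a b k : ℤ) : ‖sg a b k‖ ≤ 1 := by
  rw [sg]; split_ifs <;> first | (exfalso; omega) | simp

lemma sg_supp (a b k : ℤ) (h : k ∉ Finset.Ico (min a b) (max a b)) : sg a b k = 0 := by
  rw [Finset.mem_Ico] at h
  rw [sg, if_neg (by omega), if_neg (by omega), sub_zero]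

lemma geom_aux {x : ℂ} (hx : x ≠ 0) (hx1 : 1 - x ≠ 0) (a b : ℤ) (hab : a ≤ b) :
    ∑' k, sg a b k * x ^ k = (x ^ a - x ^ b) * (1 - x)⁻¹ := by
  rw [tsum_eq_sum (s := Finset.Ico a b)]
  · have : ∀ k ∈ Finset.Ico a b, sg a b k * x ^ k = x ^ k := by
      intro k hk
      rw [Finset.mem_Ico] at hk
      rw [sg, if_pos hk, if_neg (by omega), sub_zero, one_mul]
    rw [Finset.sum_congr rfl this]
    induction b, hab using Int.leInduction with
    | base => simp
    | succ b hb ih =>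
      rw [← Finset.insert_Ico_right_eq_Ico_add_one hb, Finset.sum_insert (by simp), ih,
        zpow_add₀ hx, zpow_one]
      · field_simp; ring
      · intro k hk
        rw [Finset.mem_Ico] at hk
        rw [sg, if_pos hk, if_neg (by omega), sub_zero, one_mul]
  · intro k hk
    rw [sg_supp, zero_mul]
    rwa [min_eq_left hab, max_eq_right hab]

lemma geom {x : ℂ} (hx : x ≠ 0) (hx1 : 1 - x ≠ 0) (a b : ℤ) :
    ∑' k, sg a b k * x ^ k = (x ^ a - x ^ b) * (1 - x)⁻¹ := by
  rcases le_total a b with h | h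
  · exact geom_aux hx hx1 a b h
  · simp only [sg_swap a b, neg_mul]
    rw [tsum_neg, geom_aux hx hx1 b a h]
    ring

lemma zpow_between {r : ℝ} (hr : 0 < r) (a b k : ℤ) (h : min a b ≤ k) (h' : k ≤ max a b) :
    r ^ k ≤ r ^ a + r ^ b := by
  have ha : 0 < r ^ a := zpow_pos hr a
  have hb : 0 < r ^ b := zpow_pos hr b
  have key : r ^ k ≤ r ^ (min a b) ∨ r ^ k ≤ r ^ (max a b) := by
    rcases le_total 1 r with h1 | h1
    · right; exact zpow_le_zpow_right₀ h1 h'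
    · left; exact zpow_le_zpow_right_of_le_one₀ hr h1 h
  rcases le_total a b with hab | hab
  · rw [min_eq_left hab, max_eq_right hab] at key
    rcases key with h | h <;> linarith
  · rw [min_eq_right hab, max_eq_left hab] at key
    rcases key with h | h <;> linarith

lemma geom_norm {x : ℂ} (hx : x ≠ 0) (c : ℂ) (a b : ℤ) :
    (Summable fun k => ‖sg a b k * (c * x ^ k)‖) ∧
    ∑' k, ‖sg a b k * (c * x ^ k)‖ ≤ |(b:ℝ) - a| * (‖c‖ * (‖x‖ ^ a + ‖x‖ ^ b)) := by
  have hz : ∀ k ∉ Finset.Ico (min a b) (max a b), ‖sg a b k * (c * x ^ k)‖ = 0 := by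
    intro k hk; rw [sg_supp a b k hk, zero_mul, norm_zero]
  refine ⟨summable_of_ne_finset_zero hz, ?_⟩
  rw [tsum_eq_sum hz]
  have hle : ∀ k ∈ Finset.Ico (min a b) (max a b),
      ‖sg a b k * (c * x ^ k)‖ ≤ ‖c‖ * (‖x‖ ^ a + ‖x‖ ^ b) := by
    intro k hk
    rw [Finset.mem_Ico] at hk
    rw [norm_mul, norm_mul, norm_zpow]
    have h1 := zpow_between (norm_pos_iff.mpr hx) a b k hk.1 hk.2.le
    calc _ ≤ 1 * (‖c‖ * ‖x‖ ^ k) := by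
          gcongr; exact sg_norm a b k
      _ ≤ _ := by rw [one_mul]; gcongr
  refine (Finset.sum_le_card_nsmul _ _ _ hle).trans ?_
  rw [nsmul_eq_mul, Int.card_Ico]
  gcongr
  have : ((max a b - min a b).toNat : ℤ) = |b - a| := by
    rw [Int.toNat_of_nonneg (by omega), max_sub_min_eq_abs]
  have h2 : (((max a b - min a b).toNat : ℤ) : ℝ) = ((|b - a| : ℤ) : ℝ) := by rw [this]
  push_cast at h2
  exact h2.le

def aj (Q : ℂ) (M ν j : ℤ) : ℂ := (-1) ^ j * Q ^ ((M + 1) * j ^ 2 + (2 * ν + 1) * j)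

def tt (Q w : ℂ) (M ν j n k : ℤ) : ℂ :=
  (-1) ^ (j + n) * (Q ^ ((M + 1) * j ^ 2 + (2 * ν + 1) * j + n ^ 2 + n
    + 2 * n * (k - ((M + 1) * j + ν + 1))) * w ^ k)

def en (Q w : ℂ) (M ν n : ℤ) : ℂ := Q ^ (- M * n ^ 2) * (w * Q ^ (2 * n)) ^ (M * (n - ν))

lemma tt_eq {Q w : ℂ} (hQ : Q ≠ 0) (M ν j n k : ℤ) :
    tt Q w M ν j n k = aj Q M ν j * bt Q n * Q ^ (-(2 * n * ((M + 1) * j + ν + 1)))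
      * (w * Q ^ (2 * n)) ^ k := by
  rw [tt, aj, bt, mul_zpow, ← zpow_mul, zpow_add₀ (by norm_num : (-1:ℂ) ≠ 0)]
  have : Q ^ ((M + 1) * j ^ 2 + (2 * ν + 1) * j + n ^ 2 + n
    + 2 * n * (k - ((M + 1) * j + ν + 1))) = Q ^ ((M + 1) * j ^ 2 + (2 * ν + 1) * j) *
      Q ^ (n ^ 2 + n) * Q ^ (-(2 * n * ((M + 1) * j + ν + 1))) * Q ^ (2 * n * k) := by
    rw [← zpow_add₀ hQ, ← zpow_add₀ hQ, ← zpow_add₀ hQ]; congr 1; ring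
  rw [this]; ring

lemma neg_one_zpow_sub (j n : ℤ) : (-1 : ℂ) ^ (j - n) = (-1) ^ j * (-1) ^ n := by
  rw [sub_eq_add_neg, zpow_add₀ (by norm_num), zpow_neg, ← inv_zpow]; norm_num

lemma ab_shear {Q : ℂ} (hQ : Q ≠ 0) (M ν j n : ℤ) :
    aj Q M ν j * bt Q n * Q ^ (-(2 * n * ((M + 1) * j + ν + 1))) =
      aj Q M ν (j - n) * Q ^ (- M * n ^ 2) := by
  rw [aj, aj, bt, neg_one_zpow_sub]
  have : Q ^ ((M + 1) * j ^ 2 + (2 * ν + 1) * j) * Q ^ (n ^ 2 + n) *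
      Q ^ (-(2 * n * ((M + 1) * j + ν + 1))) =
      Q ^ ((M + 1) * (j - n) ^ 2 + (2 * ν + 1) * (j - n)) * Q ^ (- M * n ^ 2) := by
    rw [← zpow_add₀ hQ, ← zpow_add₀ hQ, ← zpow_add₀ hQ]; congr 1; ring
  linear_combination (-1 : ℂ) ^ j * (-1) ^ n * this

def lin (l : ℤ) : ℂ := ((1 + |(l:ℝ)| : ℝ) : ℂ)

lemma norm_lin (l : ℤ) : ‖lin l‖ = (1 + |(l:ℝ)|) := by
  rw [lin, Complex.norm_real, Real.norm_eq_abs, abs_of_nonneg (by positivity)]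

lemma lin_norm (l : ℤ) : ‖lin l * (-1) ^ l‖ ≤ 1 * (1 + |(l:ℝ)|) := by
  rw [norm_mul, norm_neg_one_zpow', mul_one, one_mul, norm_lin]

lemma aj_summable {Q y : ℂ} (hQ : Q ≠ 0) (hQ1 : ‖Q‖ < 1) (hy : y ≠ 0) (M ν : ℤ) (hM : 0 < M) :
    Summable fun j : ℤ => (1 + |(j:ℝ)|) * ‖aj Q M ν j * y ^ ((M + 1) * j + ν + 1)‖ := by
  have := (gsC Q (y ^ (M + 1)) hQ hQ1 (zpow_ne_zero _ hy) (M + 1) (2 * ν + 1) (by omega) 1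
    (fun l => lin l * (-1) ^ l) lin_norm).mul_right (‖y ^ (ν + 1)‖)
  refine this.congr fun j => ?_
  rw [← norm_lin, ← norm_mul, ← norm_mul, aj, add_assoc, zpow_add₀ hy ((M + 1) * j), zpow_mul]
  congr 1; ring

lemma bt_summable {Q : ℂ} (hQ : Q ≠ 0) (hQ1 : ‖Q‖ < 1) :
    Summable fun n : ℤ => (1 + |(n:ℝ)|) * ‖bt Q n‖ := by
  have := (gsC Q 1 hQ hQ1 one_ne_zero 1 1 (by omega) 1
    (fun l => lin l * (-1) ^ l) lin_norm)
  refine this.congr fun j => ?_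
  rw [← norm_lin, ← norm_mul, bt]
  congr 1; rw [one_zpow]; ring

lemma en_summable {Q w : ℂ} (hQ : Q ≠ 0) (hQ1 : ‖Q‖ < 1) (hw : w ≠ 0) (M ν : ℤ) (hM : 0 < M) :
    Summable fun n : ℤ => (1 + |(n:ℝ)|) * ‖en Q w M ν n‖ := by
  have := (gsC Q (w ^ M) hQ hQ1 (zpow_ne_zero _ hw) M (-2 * M * ν) hM 1
    (fun l => lin l * (-1) ^ l) lin_norm).mul_right (‖w ^ (- M * ν)‖)
  refine this.congr fun n => ?_
  have e : en Q w M ν n = Q ^ (M * n ^ 2 + -2 * M * ν * n) * (w ^ M) ^ n * w ^ (- M * ν) := by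
    rw [en, mul_zpow, ← zpow_mul, mul_left_comm, ← zpow_add₀ hQ, ← zpow_mul, mul_assoc (Q ^ (M * n ^ 2 + -2 * M * ν * n)),
      ← zpow_add₀ hw, mul_comm]
    congr 2 <;> ring
  rw [e, ← norm_lin, ← norm_mul, norm_mul, norm_mul, norm_mul, norm_neg_one_zpow', norm_mul, norm_mul,
    norm_mul]
  ring

def shear : ℤ × ℤ ≃ ℤ × ℤ where
  toFun p := (p.1 - p.2, p.2)
  invFun p := (p.1 + p.2, p.2)
  left_inv p := by simp
  right_inv p := by simp

lemma cnt_bound (M ν : ℤ) (hM : 0 < M) : ∃ K : ℝ, 0 < K ∧ ∀ j n : ℤ,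
    |((((M + 1) * j + ν + 1 : ℤ)) : ℝ) - ((M * (n - ν) : ℤ) : ℝ)| ≤ K * ((1 + |(j:ℝ)|) * (1 + |(n:ℝ)|)) ∧
    |((((M + 1) * j + ν + 1 : ℤ)) : ℝ) - ((M * (n - ν) : ℤ) : ℝ)| ≤
      K * ((1 + |((j - n : ℤ):ℝ)|) * (1 + |(n:ℝ)|)) := by
  have hM' : (0:ℝ) < M := by exact_mod_cast hM
  set L : ℝ := (M + 1) * (1 + |(ν:ℝ)|) with hL
  have hL0 : 0 < L := by positivity
  have main : ∀ j n : ℤ, |((((M + 1) * j + ν + 1 : ℤ)) : ℝ) - ((M * (n - ν) : ℤ) : ℝ)| ≤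
      L * (1 + |(j:ℝ)| + |(n:ℝ)|) := by
    intro j n
    push_cast
    have e : ((M:ℝ) + 1) * j + ν + 1 - M * (n - ν) = (M + 1) * j + (M + 1) * ν + 1 - M * n := by ring
    rw [e]
    have a1 : |((M:ℝ) + 1) * j| = (M + 1) * |(j:ℝ)| := by rw [abs_mul, abs_of_pos (by positivity)]
    have a2 : |((M:ℝ) + 1) * ν| = (M + 1) * |(ν:ℝ)| := by rw [abs_mul, abs_of_pos (by positivity)]
    have a3 : |(M:ℝ) * n| = M * |(n:ℝ)| := by rw [abs_mul, abs_of_pos (by positivity)]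
    have b1 := abs_sub (((M:ℝ) + 1) * j + (M + 1) * ν + 1) (M * n)
    have b2 := abs_add_le (((M:ℝ) + 1) * j + (M + 1) * ν) 1
    have b3 := abs_add_le (((M:ℝ) + 1) * j) ((M + 1) * ν)
    rw [abs_one] at b2
    have c1 := abs_nonneg (j:ℝ)
    have c2 := abs_nonneg (n:ℝ)
    have c3 := abs_nonneg (ν:ℝ)
    have d1 : 0 ≤ (M + 1) * |(ν:ℝ)| * |(j:ℝ)| := by positivity
    have d2 : 0 ≤ (M + 1) * |(ν:ℝ)| * |(n:ℝ)| := by positivity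
    rw [hL]
    nlinarith
  refine ⟨2 * L, by positivity, fun j n => ⟨(main j n).trans ?_, (main j n).trans ?_⟩⟩
  · rw [mul_assoc 2 L, mul_left_comm]
    refine mul_le_mul_of_nonneg_left ?_ hL0.le
    nlinarith [abs_nonneg (j:ℝ), abs_nonneg (n:ℝ), mul_nonneg (abs_nonneg (j:ℝ)) (abs_nonneg (n:ℝ))]
  · rw [mul_assoc 2 L, mul_left_comm]
    refine mul_le_mul_of_nonneg_left ?_ hL0.le
    have : |(j:ℝ)| ≤ |((j - n : ℤ):ℝ)| + |(n:ℝ)| := by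
      have := abs_add_le ((j - n : ℤ):ℝ) (n:ℝ)
      push_cast at this ⊢
      rwa [sub_add_cancel] at this
    nlinarith [abs_nonneg ((j - n : ℤ):ℝ), abs_nonneg (n:ℝ),
      mul_nonneg (abs_nonneg ((j - n : ℤ):ℝ)) (abs_nonneg (n:ℝ))]

lemma triple_summable {Q w : ℂ} (hQ : Q ≠ 0) (hQ1 : ‖Q‖ < 1) (hw : w ≠ 0) (M ν : ℤ) (hM : 0 < M) :
    Summable fun p : (ℤ × ℤ) × ℤ =>
      sg (M * (p.1.2 - ν)) ((M + 1) * p.1.1 + ν + 1) p.2 * tt Q w M ν p.1.1 p.1.2 p.2 := by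
  obtain ⟨K, hK0, hK⟩ := cnt_bound M ν hM
  have W1 := ((aj_summable hQ hQ1 hw M ν hM).mul_of_nonneg (bt_summable hQ hQ1)
    (fun j => by positivity) (fun j => by positivity)).mul_left K
  have W2 := ((aj_summable hQ hQ1 one_ne_zero M ν hM).mul_of_nonneg (en_summable hQ hQ1 hw M ν hM)
    (fun j => by positivity) (fun j => by positivity)).mul_left K
  rw [← shear.summable_iff] at W2
  apply Summable.of_norm
  rw [summable_prod_of_nonneg (fun _ => norm_nonneg _)]
  have hx : ∀ n : ℤ, w * Q ^ (2 * n) ≠ 0 := fun n => mul_ne_zero hw (zpow_ne_zero _ hQ)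
  constructor
  · rintro ⟨j, n⟩
    simp only [tt_eq hQ]
    exact (geom_norm (hx n) _ _ _).1
  · refine Summable.of_nonneg_of_le (fun p => tsum_nonneg fun k => norm_nonneg _) ?_ (W2.add W1)
    rintro ⟨j, n⟩
    simp only [tt_eq hQ]
    refine (geom_norm (hx n) _ _ _).2.trans ?_
    rw [mul_add, mul_add]
    refine add_le_add ?_ ?_
    · simp only [Function.comp, shear, Equiv.coe_fn_mk, one_zpow, mul_one]
      rw [← norm_zpow, ← norm_mul, ab_shear hQ, mul_assoc, ← en, norm_mul]
      calc _ ≤ (K * ((1 + |((j - n : ℤ):ℝ)|) * (1 + |(n:ℝ)|))) * (‖aj Q M ν (j - n)‖ * ‖en Q w M ν n‖) := by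
            gcongr; exact (hK j n).2
        _ = _ := by ring
    · rw [← norm_zpow, ← norm_mul, mul_zpow, ← zpow_mul]
      have : aj Q M ν j * bt Q n * Q ^ (-(2 * n * ((M + 1) * j + ν + 1))) *
        (w ^ ((M + 1) * j + ν + 1) * Q ^ (2 * n * ((M + 1) * j + ν + 1))) =
        (aj Q M ν j * w ^ ((M + 1) * j + ν + 1)) * bt Q n := by
        rw [zpow_neg]
        have : Q ^ (2 * n * ((M + 1) * j + ν + 1)) ≠ 0 := zpow_ne_zero _ hQ
        field_simp
      rw [this, norm_mul]
      calc _ ≤ (K * ((1 + |(j:ℝ)|) * (1 + |(n:ℝ)|))) *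
              (‖aj Q M ν j * w ^ ((M + 1) * j + ν + 1)‖ * ‖bt Q n‖) := by
            gcongr; exact (hK j n).1
        _ = _ := by ring

end

section
open Filter Topology

/-- sum over `n` vanishes -/
lemma tt_sum_zero {Q w : ℂ} (M ν j k : ℤ) :
    ∑' n, tt Q w M ν j n k = 0 := by
  set c := k - ((M + 1) * j + ν + 1) with hc
  have h : ∑' n, tt Q w M ν j n k = ∑' n, - tt Q w M ν j n k := by
    rw [← (Equiv.subLeft (-(1 + 2 * c))).tsum_eq]
    refine tsum_congr fun n => ?_
    rw [Equiv.subLeft_apply, tt, tt, ← neg_mul]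
    congr 1
    · have : j + (-(1 + 2 * c) - n) = j - n - (2 * c + 1) := by ring
      rw [this, neg_one_zpow_sub, neg_one_zpow_sub, zpow_add₀ (by norm_num), zpow_add₀ (by norm_num),
        zpow_mul]
      norm_num
    · congr 2
      rw [← hc]; ring
  rw [tsum_neg] at h
  exact self_eq_neg.mp h

lemma tt_n_summable {Q w : ℂ} (hQ : Q ≠ 0) (hQ1 : ‖Q‖ < 1) (M ν j k : ℤ) :
    Summable fun n => ‖tt Q w M ν j n k‖ := by
  have := (gsC Q 1 hQ hQ1 one_ne_zero 1 (1 + 2 * (k - ((M + 1) * j + ν + 1))) one_pos 1 (fun n => (-1) ^ n)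
    (fun l => by rw [norm_neg_one_zpow']; simp)).mul_left
      ‖(-1) ^ j * Q ^ ((M + 1) * j ^ 2 + (2 * ν + 1) * j) * w ^ k‖
  refine this.congr fun n => ?_
  rw [← norm_mul, tt, zpow_add₀ (by norm_num : (-1:ℂ) ≠ 0), one_zpow]
  have : Q ^ ((M + 1) * j ^ 2 + (2 * ν + 1) * j + n ^ 2 + n
    + 2 * n * (k - ((M + 1) * j + ν + 1))) = Q ^ ((M + 1) * j ^ 2 + (2 * ν + 1) * j) *
      Q ^ (1 * n ^ 2 + (1 + 2 * (k - ((M + 1) * j + ν + 1))) * n) := by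
    rw [← zpow_add₀ hQ]; congr 1; ring
  rw [this]; congr 1; ring

def sg' (ν l j n : ℤ) : ℂ :=
  (if n - l - ν ≤ 0 ∧ l < j then 1 else 0) - (if 0 < n - l - ν ∧ j ≤ l then 1 else 0)

def del (M ν k j : ℤ) : ℂ :=
  (if k < (M + 1) * j + ν + 1 then 1 else 0) - (if k / M < j then 1 else 0)

lemma sg_eq (M ν k j n : ℤ) (hM : 0 < M) :
    sg (M * (n - ν)) ((M + 1) * j + ν + 1) k = sg' ν (k / M) j n + del M ν k j := by
  have h : M * (n - ν) ≤ k ↔ n - k / M - ν ≤ 0 := by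
    rw [mul_comm, ← Int.le_ediv_iff_mul_le hM]; omega
  rw [sg, sg', del]
  by_cases h1 : M * (n - ν) ≤ k
  · have h2 := h.mp h1
    have h3 : ¬ k < M * (n - ν) := by omega
    have h4 : ¬ 0 < n - k / M - ν := by omega
    simp only [h1, h2, h3, h4, true_and, and_false, false_and, if_false]
    ring
  · have h2 := mt h.mpr h1
    have h3 : k < M * (n - ν) := by omega
    have h4 : 0 < n - k / M - ν := by omega
    simp only [h1, h2, h3, h4, true_and, and_true, false_and, if_false]
    by_cases h5 : k < (M + 1) * j + ν + 1 <;> by_cases h6 : k / M < j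
    all_goals
      simp [h5, h6, not_le.mpr, le_of_not_gt]

lemma del_norm (M ν k j : ℤ) : ‖del M ν k j‖ ≤ 1 := by
  rw [del]; split_ifs <;> simp

lemma del_supp (M ν k j : ℤ) (hM : 0 < M)
    (hj : j ∉ Finset.Icc (-(|k| + |ν| + |k / M| + 2)) (|k| + |ν| + |k / M| + 2)) :
    del M ν k j = 0 := by
  rw [Finset.mem_Icc] at hj
  have a1 := le_abs_self k
  have a2 := neg_abs_le k
  have a3 := le_abs_self ν
  have a4 := neg_abs_le ν
  have a5 := le_abs_self (k / M)
  have a6 := neg_abs_le (k / M)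
  have b1 := abs_nonneg k
  have b2 := abs_nonneg ν
  have b3 := abs_nonneg (k / M)
  rw [del]
  rcases le_or_gt j 0 with h | h
  · have h1 : j < -(|k| + |ν| + |k / M| + 2) := by omega
    have h2 : (M + 1) * j ≤ j := by nlinarith
    rw [if_neg (by omega), if_neg (by omega), sub_zero]
  · have h1 : (|k| + |ν| + |k / M| + 2) < j := by omega
    have h2 : j ≤ (M + 1) * j := by nlinarith
    rw [if_pos (by omega), if_pos (by omega), sub_self]

lemma del_sum {Q w : ℂ} (hQ : Q ≠ 0) (hQ1 : ‖Q‖ < 1) (M ν k : ℤ) (hM : 0 < M) :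
    HasSum (fun p : ℤ × ℤ => del M ν k p.1 * tt Q w M ν p.1 p.2 k) 0 := by
  have hs : Summable (fun p : ℤ × ℤ => del M ν k p.1 * tt Q w M ν p.1 p.2 k) := by
    apply Summable.of_norm
    rw [summable_prod_of_nonneg (fun _ => norm_nonneg _)]
    constructor
    · intro j
      simp only [norm_mul]
      exact (tt_n_summable hQ hQ1 M ν j k).mul_left _
    · refine summable_of_ne_finset_zero (s := Finset.Icc (-(|k| + |ν| + |k / M| + 2)) (|k| + |ν| + |k / M| + 2)) ?_
      intro j hj
      simp only [del_supp M ν k j hM hj, zero_mul, norm_zero, tsum_zero]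
  have := hs.hasSum
  rw [hs.tsum_prod] at this
  simpa only [tsum_mul_left, tt_sum_zero, mul_zero, tsum_zero] using this

def Ck (Q w : ℂ) (M ν k : ℤ) : ℂ := ∑' p : ℤ × ℤ, sg' ν (k / M) p.1 p.2 * tt Q w M ν p.1 p.2 k

lemma Ck_eq {Q w : ℂ} (hQ : Q ≠ 0) (hQ1 : ‖Q‖ < 1) (hw : w ≠ 0) (M ν k : ℤ) (hM : 0 < M) :
    ∑' p : ℤ × ℤ, sg (M * (p.2 - ν)) ((M + 1) * p.1 + ν + 1) k * tt Q w M ν p.1 p.2 k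
      = Ck Q w M ν k := by
  have hs : Summable fun p : ℤ × ℤ =>
      sg (M * (p.2 - ν)) ((M + 1) * p.1 + ν + 1) k * tt Q w M ν p.1 p.2 k :=
    (triple_summable hQ hQ1 hw M ν hM).comp_injective (i := fun p : ℤ × ℤ => (p, k))
      (fun a b h => (Prod.mk.inj h).1)
  have h := hs.hasSum.sub (del_sum (w := w) hQ hQ1 M ν k hM)
  rw [sub_zero] at h
  rw [← h.tsum_eq, Ck]
  refine tsum_congr fun p => ?_
  rw [sg_eq M ν k _ _ hM]; ring

lemma main_sum {Q w : ℂ} (hQ : Q ≠ 0) (hQ1 : ‖Q‖ < 1) (hw : w ≠ 0)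
    (hw1 : ∀ k : ℤ, 1 - w * Q ^ (2 * k) ≠ 0) (M ν : ℤ) (hM : 0 < M) :
    Summable (Ck Q w M ν) ∧
    (∑' j, aj Q M ν j * w ^ ((M + 1) * j + ν + 1)) *
      (∑' k : ℤ, bt Q k * (1 - w * Q ^ (2 * k))⁻¹) =
    (∑' j, aj Q M ν j) * (∑' n, en Q w M ν n * (1 - w * Q ^ (2 * n))⁻¹) - ∑' k, Ck Q w M ν k := by
  have hT := triple_summable hQ hQ1 hw M ν hM
  have hT' := hT.prod_symm
  have e1 : ∀ k : ℤ, ∑' p : ℤ × ℤ, sg (M * (p.2 - ν)) ((M + 1) * p.1 + ν + 1) k *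
    tt Q w M ν p.1 p.2 k = Ck Q w M ν k := fun k => Ck_eq hQ hQ1 hw M ν k hM
  have hC : Summable (Ck Q w M ν) := by
    have := hT'.prod
    simpa only [Prod.swap, e1] using this
  refine ⟨hC, ?_⟩
  have one_le : ∀ j : ℤ, (1:ℝ) ≤ 1 + |(j:ℝ)| := fun j => by
    have := abs_nonneg (j:ℝ); linarith
  have s1 : Summable fun j => ‖aj Q M ν j * w ^ ((M + 1) * j + ν + 1)‖ :=
    Summable.of_nonneg_of_le (fun j => norm_nonneg _)
      (fun j => le_mul_of_one_le_left (norm_nonneg _) (one_le j)) (aj_summable hQ hQ1 hw M ν hM)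
  have s2 : Summable fun j => ‖aj Q M ν j‖ := by
    refine Summable.of_nonneg_of_le (fun j => norm_nonneg _)
      (fun j => ?_) (aj_summable hQ hQ1 one_ne_zero M ν hM)
    rw [one_zpow, mul_one]
    exact le_mul_of_one_le_left (norm_nonneg _) (one_le j)
  have s3 : Summable fun n => ‖en Q w M ν n * (1 - w * Q ^ (2 * n))⁻¹‖ := by
    obtain ⟨C, hC0, hC⟩ := inv_bdd hQ hQ1 hw
    refine Summable.of_nonneg_of_le (fun j => norm_nonneg _)
      (fun j => ?_) ((en_summable hQ hQ1 hw M ν hM).mul_right C)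
    rw [norm_mul]
    refine mul_le_mul ?_ (hC j) (norm_nonneg _) (by positivity)
    exact le_mul_of_one_le_left (norm_nonneg _) (one_le j)
  have hS := S_summable hQ hQ1 hw
  rw [tsum_mul_tsum_of_summable_norm s1 hS, tsum_mul_tsum_of_summable_norm s2 s3]
  have p1 := summable_mul_of_summable_norm s1 hS
  have p2 := summable_mul_of_summable_norm s2 s3
  rw [← shear.tsum_eq (fun x : ℤ × ℤ => aj Q M ν x.1 * (en Q w M ν x.2 * (1 - w * Q ^ (2 * x.2))⁻¹))]
  have p2' := shear.summable_iff.mpr p2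
  have ec : ∑' k, Ck Q w M ν k = ∑' p : ℤ × ℤ, ∑' k, 
      sg (M * (p.2 - ν)) ((M + 1) * p.1 + ν + 1) k * tt Q w M ν p.1 p.2 k := by
    simp only [← e1]
    exact (Summable.tsum_comm (f := fun (k : ℤ) (p : ℤ × ℤ) =>
      sg (M * (p.2 - ν)) ((M + 1) * p.1 + ν + 1) k * tt Q w M ν p.1 p.2 k) hT').symm
  rw [ec]
  refine Eq.trans ?_ (Summable.tsum_sub p2' hT.prod)
  refine tsum_congr fun p => ?_
  obtain ⟨j, n⟩ := p
  simp only [shear, Equiv.coe_fn_mk, Function.comp]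
  have hx : w * Q ^ (2 * n) ≠ 0 := mul_ne_zero hw (zpow_ne_zero _ hQ)
  simp only [tt_eq hQ, mul_left_comm (sg _ _ _)]
  rw [tsum_mul_left, geom hx (hw1 n), en]
  have h1 : w ^ ((M + 1) * j + ν + 1) =
      Q ^ (-(2 * n * ((M + 1) * j + ν + 1))) * (w * Q ^ (2 * n)) ^ ((M + 1) * j + ν + 1) := by
    rw [mul_zpow, ← zpow_mul, mul_left_comm, ← zpow_add₀ hQ, neg_add_cancel, zpow_zero, mul_one]
  rw [h1]
  linear_combination ((w * Q ^ (2 * n)) ^ (M * (n - ν)) * (1 - w * Q ^ (2 * n))⁻¹) * (ab_shear hQ M ν j n)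

end

lemma e2_add (a b : ℂ) : e2 (a + b) = e2 a * e2 b := by
  rw [e2, e2, e2, ← Complex.exp_add]; congr 1; ring

lemma e2_ne (a : ℂ) : e2 a ≠ 0 := Complex.exp_ne_zero _

lemma e2_zpow (a : ℂ) (n : ℤ) : e2 a ^ n = e2 (n * a) := by
  rw [e2, e2, ← Complex.exp_int_mul]; congr 1; ring

lemma e2_pow (a : ℂ) (n : ℕ) : e2 a ^ n = e2 (n * a) := by
  rw [e2, e2, ← Complex.exp_nat_mul]; congr 1; ring

lemma e2_eq_one {a : ℂ} (h : e2 a = 1) : ∃ n : ℤ, a = n := by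
  rw [e2, Complex.exp_eq_one_iff] at h
  obtain ⟨n, hn⟩ := h
  refine ⟨n, ?_⟩
  have : 2 * (Real.pi : ℂ) * Complex.I ≠ 0 := Complex.two_pi_I_ne_zero
  apply mul_left_cancel₀ this
  rw [hn]; ring

lemma norm_e2_lt {τ : ℂ} (hτ : 0 < τ.im) : ‖e2 (τ / 2)‖ < 1 := by
  rw [e2, Complex.norm_exp, Real.exp_lt_one_iff]
  have : (2 * (Real.pi : ℂ) * Complex.I * (τ / 2)) = Real.pi * (Complex.I * τ) := by ring
  rw [this, Complex.re_ofReal_mul, Complex.I_mul_re]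
  have := mul_pos Real.pi_pos hτ
  linarith

lemma eta_cube (τ : ℂ) : dedekindEta τ ^ 3 = e2 (τ / 8) * qpinf (e2 (τ / 2)) ^ 3 := by
  rw [dedekindEta, mul_pow, e2_pow, qpinf]
  congr 1
  · congr 1; push_cast; ring
  · congr 1
    refine tprod_congr fun k => ?_
    rw [e2_pow, e2_pow]
    congr 2; push_cast; ring

lemma theta_half (τ z : ℂ) : jtheta (-1) (1 / 2) (1 / 2) τ z =
    -(e2 (τ / 8) * e2 (-z / 4)) *
      ∑' l : ℤ, (-1 : ℂ) ^ l * (e2 (τ / 2) ^ (l ^ 2 - l) * e2 (z / 2) ^ l) := by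
  rw [jtheta, ← tsum_mul_left, ← (Equiv.subRight (1 : ℤ)).tsum_eq]
  refine tsum_congr fun l => ?_
  rw [Equiv.subRight_apply, neg_one_zpow_sub, e2_zpow, e2_zpow]
  have : e2 (1 / 2 * (((l - 1 : ℤ) : ℂ) + 1 / 2 / (2 * (1 / 2))) ^ 2 * τ
      + 1 / 2 * (((l - 1 : ℤ) : ℂ) + 1 / 2 / (2 * (1 / 2))) * z)
      = e2 (τ / 8) * e2 (-z / 4) * (e2 (((l ^ 2 - l : ℤ) : ℂ) * (τ / 2)) * e2 (l * (z / 2))) := by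
    simp only [← e2_add]
    congr 1; push_cast; ring
  rw [this, zpow_one]; ring

lemma theta_num (M : ℕ) (ν : ℤ) (τ z : ℂ) :
    jtheta (-1) ((ν : ℂ) + 1 / 2) ((M : ℂ) / 2 + 1 / 2) τ z =
    e2 (((ν : ℂ) + 1 / 2) ^ 2 / (2 * (M + 1)) * τ) * e2 (-z / 4) *
      ∑' j : ℤ, aj (e2 (τ / 2)) M ν j * e2 (z / 2) ^ (((M : ℤ) + 1) * j + ν + 1) := by
  rw [jtheta, ← tsum_mul_left]
  refine tsum_congr fun j => ?_
  rw [aj, e2_zpow, e2_zpow, mul_assoc ((-1 : ℂ) ^ j), mul_left_comm _ ((-1 : ℂ) ^ j)]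
  congr 1
  simp only [← e2_add]
  have hM : (M : ℂ) + 1 ≠ 0 := by exact_mod_cast Nat.succ_ne_zero M
  congr 1; push_cast
  rw [show 2 * ((M : ℂ) / 2 + 1 / 2) = M + 1 by ring, show (M : ℂ) / 2 + 1 / 2 = (M + 1) / 2 by ring]
  field_simp; ring

lemma theta_num0 (M : ℕ) (ν : ℤ) (τ : ℂ) :
    jtheta (-1) ((ν : ℂ) + 1 / 2) ((M : ℂ) / 2 + 1 / 2) τ 0 =
    e2 (((ν : ℂ) + 1 / 2) ^ 2 / (2 * (M + 1)) * τ) * ∑' j : ℤ, aj (e2 (τ / 2)) M ν j := by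
  rw [theta_num]
  have : e2 0 = 1 := by simp [e2]
  simp [this]

lemma tt_id (M : ℕ) (hM : 0 < M) (ν p l jg r k : ℤ) (τ z : ℂ) (hk : k = M * l + r) :
    (-1 : ℂ) ^ ν * e2 (((ν : ℂ) + 1 / 2) ^ 2 / (2 * (M + 1)) * τ) *
      tt (e2 (τ / 2)) (e2 (z / 2)) M ν (p + l - jg) (p + l + ν) k =
    ((-1 : ℂ) ^ jg *
      e2 ((((M : ℂ) / 2 + 1 / 2) * ((jg : ℂ) + (ν : ℂ) - ((ν : ℂ) + 1 / 2) / (2 * ((M : ℂ) / 2) + 1)) ^ 2 -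
        (M : ℂ) / 2 * ((p : ℂ) + (ν : ℂ) - (r : ℂ) / (2 * ((M : ℂ) / 2))) ^ 2) * τ)) *
    e2 ((M : ℂ) / 2 * ((l : ℂ) + r / (2 * ((M : ℂ) / 2))) ^ 2 * τ +
      (M : ℂ) / 2 * ((l : ℂ) + r / (2 * ((M : ℂ) / 2))) * z) := by
  have hM1 : (M : ℂ) + 1 ≠ 0 := by exact_mod_cast Nat.succ_ne_zero M
  have hM0 : (M : ℂ) ≠ 0 := by exact_mod_cast hM.ne'
  have hs : (-1 : ℂ) ^ ν * (-1) ^ ((p + l - jg) + (p + l + ν)) = (-1) ^ jg := by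
    rw [← zpow_add₀ (by norm_num), show ν + ((p + l - jg) + (p + l + ν)) = jg + 2 * (p + l + ν - jg) by ring,
      zpow_add₀ (by norm_num), zpow_mul]
    norm_num
  rw [tt, ← hs, e2_zpow, e2_zpow]
  have he : e2 (((ν : ℂ) + 1 / 2) ^ 2 / (2 * (M + 1)) * τ) *
      (e2 ((((M + 1) * (p + l - jg) ^ 2 + (2 * ν + 1) * (p + l - jg) + (p + l + ν) ^ 2 + (p + l + ν)
    + 2 * (p + l + ν) * (k - ((M + 1) * (p + l - jg) + ν + 1)) : ℤ) : ℂ) * (τ / 2)) * e2 (k * (z / 2)))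
     = e2 ((((M : ℂ) / 2 + 1 / 2) * ((jg : ℂ) + (ν : ℂ) - ((ν : ℂ) + 1 / 2) / (2 * ((M : ℂ) / 2) + 1)) ^ 2 -
        (M : ℂ) / 2 * ((p : ℂ) + (ν : ℂ) - (r : ℂ) / (2 * ((M : ℂ) / 2))) ^ 2) * τ) *
    e2 ((M : ℂ) / 2 * ((l : ℂ) + r / (2 * ((M : ℂ) / 2))) ^ 2 * τ +
      (M : ℂ) / 2 * ((l : ℂ) + r / (2 * ((M : ℂ) / 2))) * z) := by
    simp only [← e2_add]
    congr 1
    rw [hk]; push_cast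
    rw [show 2 * ((M : ℂ) / 2) = M by ring]
    field_simp
    ring
  linear_combination ((-1 : ℂ) ^ ν * (-1) ^ ((p + l - jg) + (p + l + ν))) * he

def gEquiv (ν l : ℤ) : ℤ × ℤ ≃ ℤ × ℤ where
  toFun x := (x.2 + l - x.1, x.2 + l + ν)
  invFun y := (y.2 - y.1 - ν, y.2 - l - ν)
  left_inv x := by ext <;> simp <;> ring
  right_inv x := by ext <;> simp <;> ring

lemma gfun_term (M : ℕ) (hM : 0 < M) (ν l r k : ℤ) (τ z : ℂ) (hk : k = M * l + r)
    (hl : k / (M : ℤ) = l) :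
    gfun ((M : ℂ) / 2) r ν τ * e2 ((M : ℂ) / 2 * ((l : ℂ) + r / (2 * ((M : ℂ) / 2))) ^ 2 * τ +
      (M : ℂ) / 2 * ((l : ℂ) + r / (2 * ((M : ℂ) / 2))) * z) =
    -((-1 : ℂ) ^ ν * e2 (((ν : ℂ) + 1 / 2) ^ 2 / (2 * (M + 1)) * τ)) *
      Ck (e2 (τ / 2)) (e2 (z / 2)) M ν k := by
  rw [gfun, indefSum, Ck, ← (gEquiv ν l).tsum_eq (fun p : ℤ × ℤ => sg' ν (k / (M : ℤ)) p.1 p.2 *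
    tt (e2 (τ / 2)) (e2 (z / 2)) M ν p.1 p.2 k), ← tsum_mul_left, ← tsum_mul_right]
  refine tsum_congr fun x => ?_
  obtain ⟨jg, p⟩ := x
  have h := tt_id M hM ν p l jg r k τ z hk
  simp only [gEquiv, Equiv.coe_fn_mk, hl, sg']
  rw [show p + l + ν - l - ν = p by ring]
  have i1 : (p ≤ 0 ∧ l < p + l - jg) ↔ (jg < p ∧ p ≤ 0) := by omega
  have i2 : (0 < p ∧ p + l - jg ≤ l) ↔ (0 < p ∧ p ≤ jg) := by omega
  simp only [i1, i2]
  rw [neg_mul, mul_left_comm, h, ← mul_assoc, ← neg_mul]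
  congr 1
  split_ifs <;> ring

lemma g_part (M : ℕ) (hM : 0 < M) (ν : ℤ) (τ z : ℂ)
    (hC : Summable (Ck (e2 (τ / 2)) (e2 (z / 2)) M ν)) :
    ∑ n ∈ Finset.range M, gfun ((M : ℂ) / 2) (n : ℤ) ν τ * jtheta 1 (n : ℤ) ((M : ℂ) / 2) τ z =
    -((-1 : ℂ) ^ ν * e2 (((ν : ℂ) + 1 / 2) ^ 2 / (2 * (M + 1)) * τ)) *
      ∑' k, Ck (e2 (τ / 2)) (e2 (z / 2)) M ν k := by
  have : NeZero M := ⟨hM.ne'⟩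
  have hC' := (Int.divModEquiv M).symm.summable_iff.mpr hC
  have hM' : (0 : ℤ) < M := by exact_mod_cast hM
  rw [← (Int.divModEquiv M).symm.tsum_eq]
  refine Eq.trans ?_ (congrArg _ hC'.tsum_prod.symm)
  simp only [tsum_fintype, Function.comp]
  rw [Summable.tsum_finsetSum, Finset.sum_range, Finset.mul_sum]
  · refine Finset.sum_congr rfl fun r _ => ?_
    rw [← tsum_mul_left, jtheta, ← tsum_mul_left]
    refine tsum_congr fun l => ?_
    rw [one_zpow, one_mul]
    refine gfun_term M hM ν l (r : ℕ) _ τ z ?_ ?_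
    · simp [Int.divModEquiv]; ring
    · simp only [Int.divModEquiv, Equiv.coe_fn_symm_mk]
      rw [add_comm, Int.add_mul_ediv_right _ _ hM'.ne', Int.ediv_eq_zero_of_lt (by positivity)
        (by exact_mod_cast r.2), zero_add]
  · intro r _
    exact hC'.comp_injective (i := fun l : ℤ => (l, r)) (fun a b h => (Prod.mk.inj h).1)

lemma hterm (M : ℕ) (n ν j : ℤ) (τ z : ℂ) :
    e2 ((M : ℂ) / 2 * (j : ℂ) * z + (n : ℂ) * z / 2 +
        ((M : ℂ) / 2 * (j : ℂ) ^ 2 + (n : ℂ) * ((j : ℂ) + (ν : ℂ))) * τ) /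
      (1 - e2 ((M : ℂ) / 2 * z + 2 * ((M : ℂ) / 2) * ((j : ℂ) + (ν : ℂ)) * τ)) =
    e2 (τ / 2) ^ ((M : ℤ) * j ^ 2) * e2 (z / 2) ^ ((M : ℤ) * j) *
      (e2 (z / 2) * e2 (τ / 2) ^ (2 * (j + ν))) ^ n *
      (1 - (e2 (z / 2) * e2 (τ / 2) ^ (2 * (j + ν))) ^ M)⁻¹ := by
  rw [div_eq_mul_inv]
  simp only [e2_zpow, ← e2_add, e2_pow]
  congr 2
  · push_cast; ring
  · congr 2; push_cast; ring

lemma hterm_summable (M : ℕ) (hM : 0 < M) (n ν : ℤ) (Q w : ℂ) (hQ : Q ≠ 0) (hQ1 : ‖Q‖ < 1)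
    (hw : w ≠ 0) :
    Summable fun j : ℤ => Q ^ ((M : ℤ) * j ^ 2) * w ^ ((M : ℤ) * j) *
      (w * Q ^ (2 * (j + ν))) ^ n * (1 - (w * Q ^ (2 * (j + ν))) ^ M)⁻¹ := by
  have hM' : (0 : ℤ) < M := by exact_mod_cast hM
  obtain ⟨C, hC0, hC⟩ := inv_bdd (Q := Q ^ M) (w := w ^ M) (pow_ne_zero _ hQ)
    (by rw [norm_pow]; exact pow_lt_one₀ (norm_nonneg _) hQ1 hM.ne') (pow_ne_zero _ hw)
  have h := ((gsC Q (w ^ M) hQ hQ1 (pow_ne_zero _ hw) M (2 * n) hM' 1 (fun _ => 1)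
    (fun l => by simp)).mul_right (‖w ^ n * Q ^ (2 * ν * n)‖)).mul_right C
  apply Summable.of_norm
  refine Summable.of_nonneg_of_le (fun j => norm_nonneg _) (fun j => ?_) h
  have e1 : Q ^ ((M : ℤ) * j ^ 2) * w ^ ((M : ℤ) * j) * (w * Q ^ (2 * (j + ν))) ^ n =
      1 * (Q ^ (M * j ^ 2 + 2 * n * j) * (w ^ M) ^ j) * (w ^ n * Q ^ (2 * ν * n)) := by
    rw [mul_zpow, ← zpow_mul, ← zpow_natCast, ← zpow_mul, zpow_add₀ hQ,
      show 2 * (j + ν) * n = 2 * n * j + 2 * ν * n by ring, zpow_add₀ hQ]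
    ring
  have e3 : (w * Q ^ (2 * (j + ν))) ^ M = w ^ M * (Q ^ M) ^ (2 * (j + ν)) := by
    rw [mul_pow, ← zpow_natCast (Q ^ _), ← zpow_natCast Q, ← zpow_mul, ← zpow_mul, mul_comm (M : ℤ)]
  rw [norm_mul, e1, e3, norm_mul (1 * _)]
  exact mul_le_mul_of_nonneg_left (hC _) (by positivity)

lemma h_part (M : ℕ) (hM : 0 < M) (ν : ℤ) (τ z : ℂ) (hτ : 0 < τ.im)
    (hx : ∀ k : ℤ, 1 - (e2 (z / 2) * e2 (τ / 2) ^ (2 * k)) ^ M ≠ 0)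
    (hx1 : ∀ k : ℤ, 1 - e2 (z / 2) * e2 (τ / 2) ^ (2 * k) ≠ 0) :
    e2 (-((M : ℂ) / 2 * (ν : ℂ) ^ 2) * τ) *
      ∑ n ∈ Finset.range M, hfun ((M : ℂ) / 2) (n : ℤ) ν τ z =
    ∑' n, en (e2 (τ / 2)) (e2 (z / 2)) M ν n * (1 - e2 (z / 2) * e2 (τ / 2) ^ (2 * n))⁻¹ := by
  have hQ := e2_ne (τ / 2)
  have hw := e2_ne (z / 2)
  have hQ1 := norm_e2_lt hτ
  have e0 : e2 (-((M : ℂ) / 2 * (ν : ℂ) ^ 2) * τ) = e2 (τ / 2) ^ (-(M : ℤ) * ν ^ 2) := by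
    rw [e2_zpow]; congr 1; push_cast; ring
  simp only [hfun, hterm]
  rw [e0]
  set Q := e2 (τ / 2)
  set w := e2 (z / 2)
  rw [← Summable.tsum_finsetSum (fun (n : ℕ) _ => hterm_summable M hM (n : ℤ) ν Q w hQ hQ1 hw),
    ← tsum_mul_left, ← (Equiv.addRight ν).tsum_eq (fun n => en Q w M ν n * _)]
  refine tsum_congr fun j => ?_
  simp only [Equiv.coe_addRight]
  rw [← Finset.sum_mul, ← Finset.mul_sum]
  have h1 := hx (j + ν)
  have h2 := hx1 (j + ν)
  have hg := geom_sum_mul_neg (w * Q ^ (2 * (j + ν))) M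
  have hen : en Q w M ν (j + ν) = Q ^ (-(M : ℤ) * ν ^ 2) * (Q ^ ((M : ℤ) * j ^ 2) * w ^ ((M : ℤ) * j)) := by
    rw [en, mul_zpow, ← zpow_mul, mul_left_comm, ← zpow_add₀ hQ,
      ← mul_assoc (Q ^ (-(M : ℤ) * ν ^ 2)), ← zpow_add₀ hQ, mul_comm]
    congr 2
    · ring
    · ring
  simp only [zpow_natCast]
  rw [hen]
  field_simp
  linear_combination hg

theorem stmt_9 (M : ℕ) (hM : 0 < M) (m : ℂ) (hm : m = (M : ℂ) / 2)
    (ν : ℤ) (hν : 0 ≤ ν ∧ ν ≤ (M : ℤ))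
    (τ : ℂ) (hτ : 0 < τ.im) (z : ℂ)
    (hz : ∀ a b : ℤ, m * z ≠ (a : ℂ) + (b : ℂ) * τ) :
    ∑ n ∈ Finset.range M, Gfun m (n : ℤ) ν τ z =
      -(-1 : ℂ) ^ ν * dedekindEta τ ^ 3 *
        jtheta (-1) ((ν : ℂ) + 1 / 2) (m + 1 / 2) τ z / jtheta (-1) (1 / 2) (1 / 2) τ z := by
  subst hm
  have hM' : (0 : ℤ) < M := by exact_mod_cast hM
  have hQ := e2_ne (τ / 2)
  have hw := e2_ne (z / 2)
  have hQ1 := norm_e2_lt hτ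
  have hx : ∀ k : ℤ, 1 - (e2 (z / 2) * e2 (τ / 2) ^ (2 * k)) ^ M ≠ 0 := by
    intro k hk
    rw [e2_zpow, ← e2_add, e2_pow] at hk
    obtain ⟨a, ha⟩ := e2_eq_one (sub_eq_zero.mp hk).symm
    apply hz a (-(M * k))
    push_cast at ha ⊢
    linear_combination ha
  have hx1 : ∀ k : ℤ, 1 - e2 (z / 2) * e2 (τ / 2) ^ (2 * k) ≠ 0 := by
    intro k hk
    apply hx k
    rw [← sub_eq_zero.mp hk, one_pow, sub_self]
  obtain ⟨hC, hmain⟩ := main_sum hQ hQ1 hw hx1 M ν hM'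
  have hT := theta_S hQ hQ1 hw hx1
  have hq := pow_ne_zero 3 (qpinf_ne hQ1)
  have hT0 := left_ne_zero_of_mul (hT ▸ hq)
  have hg := g_part M hM ν τ z hC
  have hh := h_part M hM ν τ z hτ hx hx1
  simp only [Gfun]
  rw [Finset.sum_add_distrib, hg, ← Finset.mul_sum, theta_num0, theta_half, theta_num, eta_cube, ← hT]
  have c1 := e2_ne (τ / 8)
  have c2 := e2_ne (-z / 4)
  rw [eq_div_iff (mul_ne_zero (neg_ne_zero.mpr (mul_ne_zero c1 c2)) hT0)]
  generalize e2 (((ν : ℂ) + 1 / 2) ^ 2 / (2 * (M + 1)) * τ) = K at *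
  rw [← hh] at hmain
  generalize (∑' l : ℤ, (-1 : ℂ) ^ l * (e2 (τ / 2) ^ (l ^ 2 - l) * e2 (z / 2) ^ l)) = T at *
  linear_combination ((-1 : ℂ) ^ ν * K * e2 (τ / 8) * e2 (-z / 4) * T) * hmain
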